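/- Let u ∈ l²_{h,0} be a grid function with Hermitian derivative u_x ∈ l²_{h,0}, and let s be the type-I cubic spline interpolating u. Then for every interior node x_j (1 ≤ j ≤ N−1), the second derivative of the spline at the node satisfies s″(x_j) = (δ̃²ₓu)_j − (h²/12)·(δ⁴ₓu)_j, where (δ̃²ₓu)_j = 2·(u_{j+1} − 2u_j + u_{j−1})/h² − ((u_x)_{j+1} − (u_x)_{j−1})/(2h). Equivalently, s″(x_j) = (u_{j+1} − 2u_j + u_{j−1})/h² − (h²/6)·(δ⁴ₓu)_j. -/

import Mathlib

open Set

/-- `IsHermDeriv N u v`: `v` is the Hermitian derivative of the grid function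
`u ∈ l²_{h,0}` (with `h = 1/N`). -/
def IsHermDeriv (N : ℕ) (u v : ℕ → ℝ) : Prop :=
  v 0 = 0 ∧ v N = 0 ∧
  ∀ j : ℕ, 1 ≤ j → j ≤ N - 1 →
    (1/6) * v (j-1) + (2/3) * v j + (1/6) * v (j+1)
      = (u (j+1) - u (j-1)) / (2 * ((1:ℝ)/N))

/-- The discrete biharmonic operator `δ⁴ₓ` (with `h = 1/N`). -/
noncomputable def dbh (N : ℕ) (u ux : ℕ → ℝ) (j : ℕ) : ℝ :=
  (12 / ((1:ℝ)/N)^2) *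
    ((ux (j+1) - ux (j-1)) / (2 * ((1:ℝ)/N))
      - (u (j+1) - 2 * u j + u (j-1)) / ((1:ℝ)/N)^2)

/-- `IsSpline N f s`: `s` is a type-I cubic spline for the data `f` on the uniform grid
`x_j = j/N`. -/
def IsSpline (N : ℕ) (f : ℕ → ℝ) (s : ℝ → ℝ) : Prop :=
  ContDiff ℝ 2 s ∧
  (∀ j : ℕ, j < N → ∃ p : Polynomial ℝ, p.degree ≤ 3 ∧
      ∀ x ∈ Set.Icc ((j : ℝ) / N) (((j : ℝ) + 1) / N), s x = p.eval x) ∧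
  (∀ j : ℕ, j ≤ N → s ((j : ℝ) / N) = f j) ∧
  s 0 = 0 ∧ deriv s 0 = 0 ∧ s 1 = 0 ∧ deriv s 1 = 0

/-- A differentiable function agreeing with a polynomial on a nondegenerate closed interval has
the derivative of that polynomial there, endpoints included. -/
theorem deriv_eqOn_Icc_of_eqOn_eval {f : ℝ → ℝ} (hf : Differentiable ℝ f) {a b : ℝ} (hab : a < b)
    {p : Polynomial ℝ} (h : EqOn f (fun x => p.eval x) (Icc a b)) :
    EqOn (deriv f) (fun x => p.derivative.eval x) (Icc a b) := by
  intro x hx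
  have hu := uniqueDiffOn_Icc hab x hx
  have h1 : HasDerivWithinAt f (deriv f x) (Icc a b) x := (hf x).hasDerivAt.hasDerivWithinAt
  have h2 : HasDerivWithinAt f (p.derivative.eval x) (Icc a b) x :=
    (p.hasDerivAt x).hasDerivWithinAt.congr h (h hx)
  exact hu.eq_deriv _ h1 h2

/-- The second derivatives of a cubic polynomial at the endpoints of an interval, in terms of its
Hermite data. -/
theorem eval_derivative_derivative_of_degree_le_three {p : Polynomial ℝ} (hp : p.degree ≤ 3)
    (a b : ℝ) :
    p.derivative.derivative.eval a * (b - a) ^ 2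
        = 6 * (p.eval b - p.eval a)
          - (b - a) * (4 * p.derivative.eval a + 2 * p.derivative.eval b) ∧
      p.derivative.derivative.eval b * (b - a) ^ 2
        = -6 * (p.eval b - p.eval a)
          + (b - a) * (2 * p.derivative.eval a + 4 * p.derivative.eval b) := by
  have hn : p.natDegree < 4 := Nat.lt_succ_of_le (Polynomial.natDegree_le_of_degree_le hp)
  rw [p.as_sum_range_C_mul_X_pow' hn]
  simp only [Finset.sum_range_succ, Finset.sum_range_zero]
  constructor <;> simp <;> ring

/-- A solution of the homogeneous recurrence `d (j-1) + 4 d j + d (j+1) = 0` with zero boundary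
values vanishes. -/
theorem eq_zero_of_diagonally_dominant_recurrence {N : ℕ} {d : ℕ → ℝ} (h0 : d 0 = 0)
    (hN : d N = 0)
    (hd : ∀ j : ℕ, 1 ≤ j → j ≤ N - 1 → d (j - 1) + 4 * d j + d (j + 1) = 0) :
    ∀ j ≤ N, d j = 0 := by
  obtain ⟨m, hm, hmax⟩ := Finset.exists_max_image (Finset.range (N + 1)) (fun j => |d j|)
    ⟨0, by simp⟩
  have hmN : m ≤ N := by simpa [Nat.lt_succ_iff] using hm
  have hmax' : ∀ j ≤ N, |d j| ≤ |d m| := fun j hj => hmax j (by simpa [Nat.lt_succ_iff] using hj)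
  have hm0 : |d m| = 0 := by
    rcases Nat.eq_zero_or_pos m with rfl | hpos
    · simp [h0]
    rcases hmN.eq_or_lt with rfl | hlt
    · simp [hN]
    have hrec := hd m hpos (by omega)
    have h1 := hmax' (m - 1) (by omega)
    have h2 := hmax' (m + 1) (by omega)
    have h4 : 4 * |d m| = |d (m - 1) + d (m + 1)| := by
      rw [show d (m - 1) + d (m + 1) = -(4 * d m) by linarith, abs_neg, abs_mul]
      norm_num
    have := abs_add_le (d (m - 1)) (d (m + 1))
    linarith [abs_nonneg (d m)]
  intro j hj
  exact abs_eq_zero.mp (le_antisymm (hm0 ▸ hmax' j hj) (abs_nonneg _))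

/-- The second derivative of a cubic spline at the two endpoints of a grid cell, in terms of its
nodal values and nodal first derivatives. -/
theorem IsSpline.deriv_deriv_cell {N : ℕ} {u : ℕ → ℝ} {s : ℝ → ℝ} (hs : IsSpline N u s)
    {j : ℕ} (hj : j < N) :
    deriv (deriv s) ((j : ℝ) / N) * ((1 : ℝ) / N) ^ 2
        = 6 * (u (j + 1) - u j) - (1 : ℝ) / N *
          (4 * deriv s ((j : ℝ) / N) + 2 * deriv s (((j + 1 : ℕ) : ℝ) / N)) ∧
      deriv (deriv s) (((j + 1 : ℕ) : ℝ) / N) * ((1 : ℝ) / N) ^ 2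
        = -6 * (u (j + 1) - u j) + (1 : ℝ) / N *
          (2 * deriv s ((j : ℝ) / N) + 4 * deriv s (((j + 1 : ℕ) : ℝ) / N)) := by
  obtain ⟨hc, hp, hu, -⟩ := hs
  obtain ⟨p, hdeg, hsp⟩ := hp j hj
  have hNpos : (0 : ℝ) < N := by exact_mod_cast (Nat.zero_le j).trans_lt hj
  have hlt : (j : ℝ) / N < ((j : ℝ) + 1) / N := by gcongr; linarith
  have h1 := deriv_eqOn_Icc_of_eqOn_eval (hc.differentiable (by norm_num)) hlt hsp
  have h2 := deriv_eqOn_Icc_of_eqOn_eval hc.differentiable_deriv_two hlt h1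
  have ha := left_mem_Icc.mpr hlt.le
  have hb := right_mem_Icc.mpr hlt.le
  have hua := hu j hj.le
  have hub := hu (j + 1) hj
  push_cast at hub ⊢
  rw [h2 ha, h2 hb, h1 ha, h1 hb, ← hua, ← hub, hsp _ ha, hsp _ hb,
    show (1 : ℝ) / N = ((j : ℝ) + 1) / N - (j : ℝ) / N by ring]
  exact eval_derivative_derivative_of_degree_le_three hdeg _ _

/-- The nodal first derivatives of the interpolating type-I cubic spline are the Hermitian
derivative of the data. -/
theorem IsSpline.deriv_eq_of_isHermDeriv {N : ℕ} (hN : 0 < N) {u ux : ℕ → ℝ} {s : ℝ → ℝ}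
    (hs : IsSpline N u s) (hux : IsHermDeriv N u ux) :
    ∀ j ≤ N, deriv s ((j : ℝ) / N) = ux j := by
  have hN' : (N : ℝ) ≠ 0 := by exact_mod_cast hN.ne'
  obtain ⟨hux0, huxN, hux⟩ := hux
  have key := eq_zero_of_diagonally_dominant_recurrence (N := N)
    (d := fun j => deriv s ((j : ℝ) / N) - ux j)
    (by simp [hux0, hs.2.2.2.2.1]) (by simp [huxN, hN', hs.2.2.2.2.2.2]) ?_
  · exact fun j hj => sub_eq_zero.mp (key j hj)
  intro j hj1 hj2
  obtain ⟨k, rfl⟩ := Nat.exists_eq_add_of_le' hj1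
  have hH := hux (k + 1) hj1 hj2
  have hl := (hs.deriv_deriv_cell (j := k) (by omega)).2
  have hr := (hs.deriv_deriv_cell (j := k + 1) (by omega)).1
  simp only [Nat.add_sub_cancel] at hH ⊢
  field_simp at hH hl hr
  have hlr := mul_left_cancel₀ hN' (hl.symm.trans hr)
  linarith

/-- The second derivative of the interpolating cubic spline at an interior node:
`s''(x_j) = (δ̃²ₓu)_j - (h²/12)(δ⁴ₓu)_j`, where
`(δ̃²ₓu)_j = 2(u_{j+1} - 2u_j + u_{j-1})/h² - ((u_x)_{j+1} - (u_x)_{j-1})/(2h)`;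
equivalently `s''(x_j) = (u_{j+1} - 2u_j + u_{j-1})/h² - (h²/6)(δ⁴ₓu)_j`. -/
theorem spline_second_derivative_at_node
    (N : ℕ) (hN : 2 ≤ N) (u ux : ℕ → ℝ)
    (hu0 : u 0 = 0) (huN : u N = 0) (hux : IsHermDeriv N u ux)
    (s : ℝ → ℝ) (hs : IsSpline N u s) :
    ∀ j : ℕ, 1 ≤ j → j ≤ N - 1 →
      deriv (deriv s) ((j : ℝ) / N)
        = (2 * (u (j+1) - 2 * u j + u (j-1)) / ((1:ℝ)/N)^2
            - (ux (j+1) - ux (j-1)) / (2 * ((1:ℝ)/N)))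
          - (((1:ℝ)/N)^2 / 12) * dbh N u ux j
      ∧ deriv (deriv s) ((j : ℝ) / N)
        = (u (j+1) - 2 * u j + u (j-1)) / ((1:ℝ)/N)^2
          - (((1:ℝ)/N)^2 / 6) * dbh N u ux j := by
  intro j hj1 hj2
  have hN' : (N : ℝ) ≠ 0 := by positivity
  have hd := hs.deriv_eq_of_isHermDeriv (by omega) hux
  obtain ⟨k, rfl⟩ := Nat.exists_eq_add_of_le' hj1
  have hl := (hs.deriv_deriv_cell (j := k) (by omega)).2
  have hr := (hs.deriv_deriv_cell (j := k + 1) (by omega)).1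
  rw [hd k (by omega), hd (k + 1) (by omega)] at hl
  rw [hd (k + 1) (by omega), hd (k + 1 + 1) (by omega)] at hr
  simp only [dbh, Nat.add_sub_cancel]
  generalize deriv (deriv s) (((k + 1 : ℕ) : ℝ) / N) = D at *
  field_simp at hl hr ⊢
  constructor <;> linarith
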